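/- For every integer n ≥ 1 and every bounded DH-polytope P ⊆ ℝⁿ, the limit lim_{ε→0⁺} μ_ε(P) exists in ℂ. (Existence of the volume V_n(P) of a polytope in the double hyperbolic space DHⁿ in the upper half-space model; part of Theorem 3.2 / Lemma 6.1(1).) -/

import Mathlib

open MeasureTheory Filter Metric

variable {n : ℕ} [NeZero n]

/-- A *DH-half-space* in `ℝⁿ` (upper half-space model of the double hyperbolic space `DHⁿ`):
either a closed ball whose center has first coordinate `0`, or the complement of an open ball
whose center has first coordinate `0`, or a closed affine half-space whose normal vector is
nonzero with first coordinate `0`. -/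
def IsDHHalfSpace (H : Set (EuclideanSpace ℝ (Fin n))) : Prop :=
  (∃ (c : EuclideanSpace ℝ (Fin n)) (r : ℝ), 0 < r ∧ c 0 = 0 ∧ H = closedBall c r) ∨
  (∃ (c : EuclideanSpace ℝ (Fin n)) (r : ℝ), 0 < r ∧ c 0 = 0 ∧ H = (ball c r)ᶜ) ∨
  (∃ (v : EuclideanSpace ℝ (Fin n)) (t : ℝ), v ≠ 0 ∧ v 0 = 0 ∧
    H = {x | t ≤ inner v x (𝕜 := ℝ)})

/-- A *DH-polytope* in `ℝⁿ`: a finite intersection of DH-half-spaces. -/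
def IsDHPolytope (P : Set (EuclideanSpace ℝ (Fin n))) : Prop :=
  ∃ S : Finset (Set (EuclideanSpace ℝ (Fin n))), (∀ H ∈ S, IsDHHalfSpace H) ∧ P = ⋂₀ ↑S

/-- `μ_ε(P) = ∫_P (x₀ - εi)^{-n} dx`. -/
noncomputable def dhInt (n : ℕ) [NeZero n] (P : Set (EuclideanSpace ℝ (Fin n))) (ε : ℝ) : ℂ :=
  ∫ x in P, ((x 0 : ℂ) - (ε : ℂ) * Complex.I) ^ (-(n : ℤ))

section SetAlgebra

variable {X Y : Type*}

/-- The indicator functions of the sets `K ∩ {w ≤ a}` and `K ∩ {w < a}` with `K ∈ 𝒦`, `a ∈ F`. -/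
def sublevelIndicators (𝒦 : Set (Set X)) (F : Set (X → ℝ)) (w : X → ℝ) : Set (X → ℝ) :=
  {f | ∃ K ∈ 𝒦, ∃ a ∈ F, f = (K ∩ {x | w x ≤ a x}).indicator 1 ∨
    f = (K ∩ {x | w x < a x}).indicator 1}

theorem indicator_mul_mem_sublevelIndicators {𝒦 : Set (Set X)} {F : Set (X → ℝ)} {w : X → ℝ}
    (h𝒦 : IsSetAlgebra 𝒦) {L : Set X} (hL : L ∈ 𝒦) {f : X → ℝ}
    (hf : f ∈ sublevelIndicators 𝒦 F w) :
    L.indicator 1 * f ∈ sublevelIndicators 𝒦 F w := by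
  obtain ⟨K, hK, a, ha, h⟩ := hf
  refine ⟨L ∩ K, h𝒦.inter_mem hL hK, a, ha, ?_⟩
  rw [Set.inter_assoc, Set.inter_assoc, Set.inter_indicator_one, Set.inter_indicator_one (s := L)]
  exact h.imp (congrArg _) (congrArg _)

theorem mul_mem_span_sublevelIndicators {𝒦 : Set (Set X)} {F : Set (X → ℝ)} {w : X → ℝ}
    (h𝒦 : IsSetAlgebra 𝒦) (hF : ∀ a ∈ F, ∀ b ∈ F, {x | a x ≤ b x} ∈ 𝒦) {f g : X → ℝ}
    (hf : f ∈ sublevelIndicators 𝒦 F w) (hg : g ∈ sublevelIndicators 𝒦 F w) :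
    f * g ∈ Submodule.span ℝ (sublevelIndicators 𝒦 F w) := by
  obtain ⟨K, hK, a, ha, hf⟩ := hf
  obtain ⟨L, hL, b, hb, hg⟩ := hg
  have hKL := h𝒦.inter_mem hK hL
  have h1 := h𝒦.inter_mem hKL (hF a ha b hb)
  have h2 := h𝒦.inter_mem hKL (h𝒦.compl_mem (hF a ha b hb))
  have h3 := h𝒦.inter_mem hKL (hF b hb a ha)
  have h4 := h𝒦.inter_mem hKL (h𝒦.compl_mem (hF b hb a ha))
  have key : ∀ {A B : Set X}, A.indicator 1 ∈ sublevelIndicators 𝒦 F w →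
      B.indicator 1 ∈ sublevelIndicators 𝒦 F w →
      (∀ x, f x * g x = A.indicator 1 x + B.indicator 1 x) →
      f * g ∈ Submodule.span ℝ (sublevelIndicators 𝒦 F w) := fun hA hB h =>
    (funext h : f * g = _ + _) ▸
      add_mem (Submodule.subset_span hA) (Submodule.subset_span hB)
  rcases hf with rfl | rfl <;> rcases hg with rfl | rfl
  · refine key ⟨_, h1, a, ha, Or.inl rfl⟩ ⟨_, h2, b, hb, Or.inl rfl⟩ fun x => ?_
    simp only [Set.indicator, Pi.one_apply, Set.mem_inter_iff, Set.mem_ofPred_eq,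
      Set.mem_compl_iff]
    grind
  · refine key ⟨_, h3, b, hb, Or.inr rfl⟩ ⟨_, h4, a, ha, Or.inl rfl⟩ fun x => ?_
    simp only [Set.indicator, Pi.one_apply, Set.mem_inter_iff, Set.mem_ofPred_eq,
      Set.mem_compl_iff]
    grind
  · refine key ⟨_, h1, a, ha, Or.inr rfl⟩ ⟨_, h2, b, hb, Or.inl rfl⟩ fun x => ?_
    simp only [Set.indicator, Pi.one_apply, Set.mem_inter_iff, Set.mem_ofPred_eq,
      Set.mem_compl_iff]
    grind
  · refine key ⟨_, h1, a, ha, Or.inr rfl⟩ ⟨_, h2, b, hb, Or.inr rfl⟩ fun x => ?_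
    simp only [Set.indicator, Pi.one_apply, Set.mem_inter_iff, Set.mem_ofPred_eq,
      Set.mem_compl_iff]
    grind

theorem preimage_mem_of_mem_generateSetAlgebra {𝒜 : Set (Set Y)} {ℬ : Set (Set X)}
    (hℬ : IsSetAlgebra ℬ) {f : X → Y} (h : ∀ s ∈ 𝒜, f ⁻¹' s ∈ ℬ) {s : Set Y}
    (hs : s ∈ generateSetAlgebra 𝒜) : f ⁻¹' s ∈ ℬ := by
  induction hs with
  | base s hs => exact h s hs
  | empty => exact hℬ.empty_mem
  | compl s _ ih => exact hℬ.compl_mem ih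
  | union s t _ _ ihs iht => exact hℬ.union_mem ihs iht

theorem measurableSet_of_mem_generateSetAlgebra [MeasurableSpace X] {𝒜 : Set (Set X)}
    (h : ∀ s ∈ 𝒜, MeasurableSet s) {s : Set X} (hs : s ∈ generateSetAlgebra 𝒜) :
    MeasurableSet s := by
  induction hs with
  | base s hs => exact h s hs
  | empty => exact MeasurableSet.empty
  | compl s _ ih => exact ih.compl
  | union s t _ _ ihs iht => exact ihs.union iht

/-- If a linear span of functions is closed under multiplication and contains the constant `1` and
the indicators of the members of `𝒜`, then it contains the indicators of all members of the algebra
of sets generated by `𝒜`. -/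
theorem indicator_mem_of_mem_generateSetAlgebra {𝒜 : Set (Set X)} {V : Submodule ℝ (X → ℝ)}
    (h1 : 1 ∈ V) (hmul : ∀ f ∈ V, ∀ g ∈ V, f * g ∈ V) (h : ∀ s ∈ 𝒜, s.indicator 1 ∈ V)
    {s : Set X} (hs : s ∈ generateSetAlgebra 𝒜) : s.indicator 1 ∈ V := by
  induction hs with
  | base s hs => exact h s hs
  | empty => rw [Set.indicator_empty']; exact zero_mem V
  | compl s _ ih => rw [Set.indicator_compl]; exact sub_mem h1 ih
  | union s t _ _ ihs iht =>
    have : (s ∪ t).indicator (1 : X → ℝ) =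
        s.indicator 1 + t.indicator 1 - s.indicator 1 * t.indicator 1 := by
      rw [← Set.inter_indicator_one, ← Set.indicator_union_add_inter, add_sub_cancel_right]
    rw [this]
    exact sub_mem (add_mem ihs iht) (hmul _ ihs _ iht)

end SetAlgebra

section Slicing

variable {E : Type*} [NormedAddCommGroup E] [InnerProductSpace ℝ E] [FiniteDimensional ℝ E]
  [MeasurableSpace E] [BorelSpace E]

theorem measurePreserving_smul_add_orthogonal {e : E} (he : ‖e‖ = 1) :
    MeasurePreserving (fun p : ℝ × (Submodule.span ℝ {e})ᗮ => p.1 • e + (p.2 : E))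
      (volume.prod volume) volume := by
  have h1 := ((LinearIsometryEquiv.toSpanUnitSingleton e he).measurePreserving).prod
    (MeasurePreserving.id (volume : Measure (Submodule.span ℝ {e})ᗮ))
  have h2 := WithLp.volume_preserving_toLp (Submodule.span ℝ {e}) (Submodule.span ℝ {e})ᗮ
  have h3 := (Submodule.span ℝ {e}).orthogonalDecomposition.symm.measurePreserving
  have h := h3.comp (h2.comp h1)
  convert! h using 1

theorem integral_eq_integral_slice {F : Type*} [NormedAddCommGroup F] [NormedSpace ℝ F] {e : E}
    (he : ‖e‖ = 1) {f : E → F} (hf : Integrable f) :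
    ∫ x, f x = ∫ u : ℝ, ∫ z : (Submodule.span ℝ {e})ᗮ, f (u • e + z) := by
  have h := measurePreserving_smul_add_orthogonal he
  rw [← integral_prod (fun p : ℝ × (Submodule.span ℝ {e})ᗮ => f (p.1 • e + (p.2 : E)))
    (h.integrable_comp_of_integrable hf)]
  rw [← integral_map h.measurable.aemeasurable (h.map_eq.symm ▸ hf.aestronglyMeasurable),
    h.map_eq]

theorem integrable_integral_slice {F : Type*} [NormedAddCommGroup F] [NormedSpace ℝ F] {e : E}
    (he : ‖e‖ = 1) {f : E → F} (hf : Integrable f) :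
    Integrable (fun u : ℝ => ∫ z : (Submodule.span ℝ {e})ᗮ, f (u • e + z)) :=
  ((measurePreserving_smul_add_orthogonal he).integrable_comp_of_integrable hf).integral_prod_left

end Slicing

section Polyhedral

variable (E : Type*) [NormedAddCommGroup E] [InnerProductSpace ℝ E]

/-- The algebra of sets generated by the affine half-spaces. -/
def polyhedralSets : Set (Set E) :=
  generateSetAlgebra {H | ∃ (v : E) (t : ℝ), H = {x | t ≤ inner ℝ v x}}

/-- The algebra of sets generated by the linear half-spaces. -/
def conicSets : Set (Set E) :=
  generateSetAlgebra {H | ∃ v : E, H = {x | 0 ≤ inner ℝ v x}}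

variable {E}

theorem measurableSet_of_mem_polyhedralSets [MeasurableSpace E] [BorelSpace E] {S : Set E}
    (hS : S ∈ polyhedralSets E) : MeasurableSet S := by
  refine measurableSet_of_mem_generateSetAlgebra ?_ hS
  rintro _ ⟨v, t, rfl⟩
  exact (isClosed_le (by fun_prop) (by fun_prop)).measurableSet

theorem conicSets_subset_polyhedralSets : conicSets E ⊆ polyhedralSets E :=
  generateSetAlgebra_mono fun _ ⟨v, h⟩ => ⟨v, 0, h⟩

theorem smul_mem_iff_of_mem_conicSets {K : Set E} (hK : K ∈ conicSets E) {r : ℝ} (hr : 0 < r)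
    (x : E) : r • x ∈ K ↔ x ∈ K := by
  induction hK with
  | base s hs =>
    obtain ⟨v, rfl⟩ := hs
    simp [inner_smul_right, mul_nonneg_iff_of_pos_left hr]
  | empty => rfl
  | compl s _ ih => exact not_congr ih
  | union s t _ _ ihs iht => exact or_congr ihs iht

theorem preimage_add_coe_mem_polyhedralSets (W : Submodule ℝ E) [W.HasOrthogonalProjection] (p : E)
    {S : Set E} (hS : S ∈ polyhedralSets E) :
    {z : W | p + z ∈ S} ∈ polyhedralSets W := by
  refine preimage_mem_of_mem_generateSetAlgebra isSetAlgebra_generateSetAlgebra ?_ hS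
  rintro _ ⟨v, t, rfl⟩
  refine self_subset_generateSetAlgebra ⟨W.orthogonalProjectionOnto v, t - inner ℝ v p, ?_⟩
  ext z
  simp [inner_add_right, add_comm]

/-- The functions spanning the indicators of the polyhedral sets: indicators of cones, possibly
truncated by an affine half-space at distance `1`. -/
def truncatedConeIndicators (E : Type*) [NormedAddCommGroup E] [InnerProductSpace ℝ E] :
    Set (E → ℝ) :=
  sublevelIndicators (conicSets E) (Set.range fun v x => inner ℝ v x) (fun _ => 1) ∪
    {f | ∃ K ∈ conicSets E, f = K.indicator 1}

theorem mul_mem_span_truncatedConeIndicators {f g : E → ℝ}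
    (hf : f ∈ Submodule.span ℝ (truncatedConeIndicators E))
    (hg : g ∈ Submodule.span ℝ (truncatedConeIndicators E)) :
    f * g ∈ Submodule.span ℝ (truncatedConeIndicators E) := by
  have hA : IsSetAlgebra (conicSets E) := isSetAlgebra_generateSetAlgebra
  induction hf, hg using Submodule.span_induction₂ with
  | mem_mem f g hf hg =>
    rcases hf with hf | ⟨K, hK, rfl⟩
    · rcases hg with hg | ⟨L, hL, rfl⟩
      · refine Submodule.span_mono Set.subset_union_left
          (mul_mem_span_sublevelIndicators hA ?_ hf hg)
        rintro _ ⟨v, rfl⟩ _ ⟨w, rfl⟩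
        refine self_subset_generateSetAlgebra ⟨w - v, ?_⟩
        ext x
        simp [inner_sub_left]
      · rw [mul_comm]
        exact Submodule.subset_span (Or.inl (indicator_mul_mem_sublevelIndicators hA hL hf))
    · rcases hg with hg | ⟨L, hL, rfl⟩
      · exact Submodule.subset_span (Or.inl (indicator_mul_mem_sublevelIndicators hA hK hg))
      · exact Submodule.subset_span
          (Or.inr ⟨K ∩ L, hA.inter_mem hK hL, (Set.inter_indicator_one).symm⟩)
  | zero_left g hg => rw [zero_mul]; exact zero_mem _
  | zero_right f hf => rw [mul_zero]; exact zero_mem _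
  | add_left f g h _ _ _ h1 h2 => rw [add_mul]; exact add_mem h1 h2
  | add_right f g h _ _ _ h1 h2 => rw [mul_add]; exact add_mem h1 h2
  | smul_left r f g _ _ h => rw [smul_mul_assoc]; exact Submodule.smul_mem _ _ h
  | smul_right r f g _ _ h => rw [mul_smul_comm]; exact Submodule.smul_mem _ _ h

theorem indicator_mem_span_truncatedConeIndicators {S : Set E} (hS : S ∈ polyhedralSets E) :
    S.indicator 1 ∈ Submodule.span ℝ (truncatedConeIndicators E) := by
  have hA : IsSetAlgebra (conicSets E) := isSetAlgebra_generateSetAlgebra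
  have h1 : (1 : E → ℝ) ∈ Submodule.span ℝ (truncatedConeIndicators E) :=
    Submodule.subset_span (Or.inr ⟨Set.univ, hA.univ_mem, by simp⟩)
  refine indicator_mem_of_mem_generateSetAlgebra h1
    (fun f hf g hg => mul_mem_span_truncatedConeIndicators hf hg) ?_ hS
  rintro _ ⟨v, t, rfl⟩
  rcases lt_trichotomy t 0 with ht | rfl | ht
  · have : {x : E | t ≤ inner ℝ v x}.indicator (1 : E → ℝ) =
        1 - (Set.univ ∩ {x : E | 1 < inner ℝ (t⁻¹ • v) x}).indicator 1 := by
      rw [← Set.indicator_compl]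
      congr 1
      ext x
      simp only [Set.mem_ofPred_eq, inner_smul_left, Set.mem_compl_iff, Set.univ_inter, not_lt]
      simp [← div_eq_inv_mul, div_le_one_of_neg ht]
    rw [this]
    exact sub_mem h1 (Submodule.subset_span
      (Or.inl ⟨_, hA.univ_mem, _, ⟨t⁻¹ • v, rfl⟩, Or.inr rfl⟩))
  · exact Submodule.subset_span (Or.inr ⟨_, self_subset_generateSetAlgebra ⟨v, rfl⟩, rfl⟩)
  · refine Submodule.subset_span
      (Or.inl ⟨_, hA.univ_mem, _, ⟨t⁻¹ • v, rfl⟩, Or.inl ?_⟩)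
    congr 1
    ext x
    simp only [Set.mem_ofPred_eq, inner_smul_left, Set.univ_inter]
    simp [← div_eq_inv_mul, one_le_div ht]

end Polyhedral

section SmoothGerm

/-- The primitive of a function that is `C^N` at `w` is `C^(N+1)` at `w`. -/
theorem contDiffAt_integral {N : ℕ} {g : ℝ → ℝ} {w : ℝ} (hg : ContDiffAt ℝ N g w) :
    ContDiffAt ℝ (N + 1 : ℕ) (fun v => ∫ u in w..v, g u) w := by
  have hgc : ∀ᶠ y in nhds w, ContinuousAt g y :=
    (hg.eventually (by simp)).mono fun y hy => hy.continuousAt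
  obtain ⟨d, hd, hgd⟩ := Metric.eventually_nhds_iff_ball.1 hgc
  have hcont : ContinuousOn g (ball w d) := fun y hy => (hgd y hy).continuousWithinAt
  refine contDiffAt_succ_iff_hasFDerivAt.2 ⟨fun y => ContinuousLinearMap.toSpanSingleton ℝ (g y),
    ⟨ball w d, ball_mem_nhds w hd, fun y hy => ?_⟩, ?_⟩
  · refine (intervalIntegral.integral_hasDerivAt_right (ContinuousOn.intervalIntegrable ?_)
      (hcont.stronglyMeasurableAtFilter isOpen_ball y hy) (hgd y hy)).hasFDerivAt
    exact hcont.mono (((convex_ball w d).ordConnected).uIcc_subset (mem_ball_self hd) hy)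
  · exact (ContinuousLinearMap.toSpanSingletonCLE (𝕜 := ℝ) (E := ℝ)).contDiff.contDiffAt.comp w hg

/-- `f` agrees along the filter `l` with a function that is `C^N` at `x`. -/
def HasSmoothGerm (N : ℕ) (f : ℝ → ℝ) (l : Filter ℝ) (x : ℝ) : Prop :=
  ∃ g : ℝ → ℝ, ContDiffAt ℝ N g x ∧ f =ᶠ[l] g

namespace HasSmoothGerm

variable {N : ℕ} {f g : ℝ → ℝ} {l : Filter ℝ} {x : ℝ}

theorem of_contDiffAt (hf : ContDiffAt ℝ N f x) : HasSmoothGerm N f l x :=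
  ⟨f, hf, EventuallyEq.rfl⟩

theorem congr (hf : HasSmoothGerm N f l x) (h : g =ᶠ[l] f) : HasSmoothGerm N g l x :=
  hf.imp fun _ hk => ⟨hk.1, h.trans hk.2⟩

theorem add (hf : HasSmoothGerm N f l x) (hg : HasSmoothGerm N g l x) :
    HasSmoothGerm N (fun y => f y + g y) l x := by
  obtain ⟨f', hf', hff'⟩ := hf
  obtain ⟨g', hg', hgg'⟩ := hg
  exact ⟨_, hf'.add hg', hff'.add hgg'⟩

theorem mul (hf : HasSmoothGerm N f l x) (hg : HasSmoothGerm N g l x) :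
    HasSmoothGerm N (fun y => f y * g y) l x := by
  obtain ⟨f', hf', hff'⟩ := hf
  obtain ⟨g', hg', hgg'⟩ := hg
  exact ⟨_, hf'.mul hg', hff'.mul hgg'⟩

theorem comp {φ : ℝ → ℝ} {l' : Filter ℝ} {y : ℝ} (hf : HasSmoothGerm N f l (φ y))
    (hφ : ContDiffAt ℝ N φ y) (h : Tendsto φ l' l) : HasSmoothGerm N (fun z => f (φ z)) l' y := by
  obtain ⟨f', hf', hff'⟩ := hf
  exact ⟨_, hf'.comp y hφ, h.eventually hff'⟩

/-- If an integrable function has a smooth germ on the right of `w`, then so does its tail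
integral. -/
theorem integral_Ioi {φ : ℝ → ℝ} {w : ℝ} (hφ : Integrable φ)
    (h : HasSmoothGerm N φ (nhdsWithin w (Set.Ioi w)) w) :
    HasSmoothGerm N (fun v => ∫ u in Set.Ioi v, φ u) (nhdsWithin w (Set.Ioi w)) w := by
  obtain ⟨g, hg, hφg⟩ := h
  obtain ⟨d, hd, hd'⟩ := mem_nhdsGT_iff_exists_Ioo_subset.1 hφg
  refine ⟨fun v => (∫ u in Set.Ioi w, φ u) - ∫ u in w..v, g u, ?_, ?_⟩
  · exact contDiffAt_const.sub ((contDiffAt_integral hg).of_le (mod_cast Nat.le_succ N))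
  · filter_upwards [Ioo_mem_nhdsGT hd] with v hv
    have hIoo : ∫ u in w..v, g u = ∫ u in w..v, φ u := by
      rw [intervalIntegral.integral_of_le hv.1.le, intervalIntegral.integral_of_le hv.1.le,
        integral_Ioc_eq_integral_Ioo, integral_Ioc_eq_integral_Ioo]
      exact setIntegral_congr_fun measurableSet_Ioo fun u hu =>
        (hd' ⟨hu.1, hu.2.trans hv.2⟩).symm
    rw [hIoo, eq_sub_iff_add_eq', intervalIntegral.integral_interval_add_Ioi hφ.integrableOn
      hφ.integrableOn]

end HasSmoothGerm

end SmoothGerm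

section TruncatedVolume

theorem measurableSet_norm_sq_le {E : Type*} [NormedAddCommGroup E] [MeasurableSpace E]
    [BorelSpace E] (σ : ℝ) : MeasurableSet {y : E | ‖y‖ ^ 2 ≤ σ} :=
  measurableSet_le (by fun_prop) measurable_const

variable {E : Type*} [NormedAddCommGroup E] [InnerProductSpace ℝ E]

theorem inner_smul_add_orthogonal {e : E} (he : ‖e‖ = 1) (u : ℝ)
    (z : (Submodule.span ℝ {e})ᗮ) : inner ℝ e (u • e + (z : E)) = u := by
  rw [inner_add_right, inner_smul_right, real_inner_self_eq_norm_sq, he,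
    Submodule.mem_orthogonal_singleton_iff_inner_right.1 z.2]
  ring

theorem norm_smul_add_orthogonal_sq {e : E} (he : ‖e‖ = 1) (u : ℝ)
    (z : (Submodule.span ℝ {e})ᗮ) : ‖u • e + (z : E)‖ ^ 2 = u ^ 2 + ‖z‖ ^ 2 := by
  rw [norm_add_sq_real, inner_smul_left, Submodule.mem_orthogonal_singleton_iff_inner_right.1 z.2,
    norm_smul, he]
  simp

variable [FiniteDimensional ℝ E] [MeasurableSpace E] [BorelSpace E]

/-- The volume of the part of `S` in the ball of radius `√σ`, as a function of `σ`. -/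
noncomputable def truncVol (S : Set E) (σ : ℝ) : ℝ :=
  volume.real (S ∩ {y | ‖y‖ ^ 2 ≤ σ})

theorem volume_norm_sq_le_lt_top (σ : ℝ) : volume {y : E | ‖y‖ ^ 2 ≤ σ} < ⊤ := by
  refine lt_of_le_of_lt (measure_mono fun y hy => ?_)
    (measure_closedBall_lt_top (x := (0 : E)) (r := √σ))
  rw [mem_closedBall_zero_iff]
  exact Real.le_sqrt_of_sq_le hy

theorem truncVol_of_neg (S : Set E) {σ : ℝ} (hσ : σ < 0) : truncVol S σ = 0 := by
  have : S ∩ {y | ‖y‖ ^ 2 ≤ σ} = ∅ :=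
    Set.eq_empty_of_forall_notMem fun y hy => absurd (hy.2.trans_lt hσ) (sq_nonneg ‖y‖).not_gt
  rw [truncVol, this, measureReal_empty]

open scoped Pointwise in
theorem measureReal_eq_pow_mul_of_smul_mem_iff {A B : Set E} {r : ℝ} (hr : 0 < r)
    (h : ∀ y, r • y ∈ A ↔ y ∈ B) :
    volume.real A = r ^ Module.finrank ℝ E * volume.real B := by
  have hA : A = r • B := by
    ext x
    rw [Set.mem_smul_set_iff_inv_smul_mem₀ hr.ne', ← h, smul_inv_smul₀ hr.ne']
  rw [hA, measureReal_def, Measure.addHaar_smul, ENNReal.toReal_mul, abs_of_pos (pow_pos hr _),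
    ENNReal.toReal_ofReal (pow_pos hr _).le, measureReal_def]

theorem truncVol_eq_of_mem_conicSets {K : Set E} (hK : K ∈ conicSets E) {σ : ℝ} (hσ : 0 < σ) :
    truncVol K σ = √σ ^ Module.finrank ℝ E * truncVol K 1 := by
  refine measureReal_eq_pow_mul_of_smul_mem_iff (Real.sqrt_pos.2 hσ) fun y => ?_
  simp only [Set.mem_inter_iff, smul_mem_iff_of_mem_conicSets hK (Real.sqrt_pos.2 hσ),
    Set.mem_ofPred_eq, norm_smul, mul_pow, Real.norm_eq_abs, sq_abs, Real.sq_sqrt hσ.le]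
  rw [mul_le_iff_le_one_right hσ]

theorem integrable_measureReal_slice {e : E} (he : ‖e‖ = 1) {A : Set E} (hA : MeasurableSet A)
    (hA' : volume A < ⊤) :
    Integrable fun u : ℝ => volume.real {z : (Submodule.span ℝ {e})ᗮ | u • e + z ∈ A} := by
  have h := integrable_integral_slice he
    ((integrable_indicator_iff hA).2 (integrableOn_const (C := (1 : ℝ)) hA'.ne))
  refine h.congr (ae_of_all _ fun u => ?_)
  have hm : MeasurableSet {z : (Submodule.span ℝ {e})ᗮ | u • e + z ∈ A} :=
    hA.preimage (by fun_prop)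
  exact integral_indicator_one hm

theorem measureReal_eq_integral_slice {e : E} (he : ‖e‖ = 1) {A : Set E} (hA : MeasurableSet A)
    (hA' : volume A < ⊤) :
    volume.real A = ∫ u : ℝ, volume.real {z : (Submodule.span ℝ {e})ᗮ | u • e + z ∈ A} := by
  have h := integral_eq_integral_slice he
    ((integrable_indicator_iff hA).2 (integrableOn_const (C := (1 : ℝ)) hA'.ne))
  rw [← integral_indicator_one hA]
  refine h.trans (integral_congr_ae (ae_of_all _ fun u => ?_))
  have hm : MeasurableSet {z : (Submodule.span ℝ {e})ᗮ | u • e + z ∈ A} :=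
    hA.preimage (by fun_prop)
  exact integral_indicator_one hm

theorem measureReal_inter_inner_mem {e : E} (he : ‖e‖ = 1) {A : Set E} (hA : MeasurableSet A)
    (hA' : volume A < ⊤) {J : Set ℝ} (hJ : MeasurableSet J) :
    volume.real (A ∩ {y | inner ℝ e y ∈ J}) =
      ∫ u in J, volume.real {z : (Submodule.span ℝ {e})ᗮ | u • e + z ∈ A} := by
  have hm : MeasurableSet {y : E | inner ℝ e y ∈ J} :=
    hJ.preimage (f := fun y => inner ℝ e y) (by fun_prop)
  rw [measureReal_eq_integral_slice he (hA.inter hm)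
    ((measure_mono Set.inter_subset_left).trans_lt hA'), ← integral_indicator hJ]
  congr 1
  ext u
  by_cases hu : u ∈ J <;> simp [inner_smul_add_orthogonal he, hu]

theorem measureReal_slice_cone {e : E} (he : ‖e‖ = 1) {K : Set E} (hK : K ∈ conicSets E) {u : ℝ}
    (hu : 0 < u) :
    volume.real {z : (Submodule.span ℝ {e})ᗮ | u • e + z ∈ K ∩ {y | ‖y‖ ^ 2 ≤ 1}} =
      u ^ Module.finrank ℝ (Submodule.span ℝ {e})ᗮ *
        truncVol {z : (Submodule.span ℝ {e})ᗮ | e + z ∈ K} ((1 - u ^ 2) / u ^ 2) := by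
  refine measureReal_eq_pow_mul_of_smul_mem_iff hu fun z => ?_
  have h : u • e + ((u • z : (Submodule.span ℝ {e})ᗮ) : E) = u • (e + z) := by simp
  simp only [Set.mem_ofPred_eq, Set.mem_inter_iff, norm_smul_add_orthogonal_sq he]
  rw [h, smul_mem_iff_of_mem_conicSets hK hu, norm_smul, mul_pow, Real.norm_eq_abs, sq_abs,
    le_div_iff₀ (by positivity), le_sub_iff_add_le', mul_comm (‖z‖ ^ 2)]

theorem hasSmoothGerm_integral_Ioi_slice_cone (N : ℕ) {e : E} (he : ‖e‖ = 1) {K : Set E}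
    (hK : K ∈ conicSets E)
    (ih : ∀ σ > 0, HasSmoothGerm N (truncVol {z : (Submodule.span ℝ {e})ᗮ | e + z ∈ K})
      (nhdsWithin σ (Set.Iio σ)) σ) {w : ℝ} (hw : 0 < w) :
    HasSmoothGerm N (fun v => ∫ u in Set.Ioi v,
      volume.real {z : (Submodule.span ℝ {e})ᗮ | u • e + z ∈ K ∩ {y | ‖y‖ ^ 2 ≤ 1}})
      (nhdsWithin w (Set.Ioi w)) w := by
  have hKm := measurableSet_of_mem_polyhedralSets (conicSets_subset_polyhedralSets hK)
  refine HasSmoothGerm.integral_Ioi (integrable_measureReal_slice he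
    (hKm.inter (measurableSet_norm_sq_le 1))
    ((measure_mono Set.inter_subset_right).trans_lt (volume_norm_sq_le_lt_top 1))) ?_
  have hev : (fun u : ℝ =>
      volume.real {z : (Submodule.span ℝ {e})ᗮ | u • e + z ∈ K ∩ {y | ‖y‖ ^ 2 ≤ 1}})
      =ᶠ[nhdsWithin w (Set.Ioi w)] fun u => u ^ Module.finrank ℝ (Submodule.span ℝ {e})ᗮ *
        truncVol {z : (Submodule.span ℝ {e})ᗮ | e + z ∈ K} ((1 - u ^ 2) / u ^ 2) := by
    filter_upwards [self_mem_nhdsWithin] with u hu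
    exact measureReal_slice_cone he hK (hw.trans hu)
  rcases lt_or_ge w 1 with h1 | h1
  · refine HasSmoothGerm.congr (.mul (.of_contDiffAt (by fun_prop)) ?_) hev
    have hσ : 0 < (1 - w ^ 2) / w ^ 2 := div_pos (by nlinarith) (by positivity)
    have hc : ContDiffAt ℝ N (fun u : ℝ => (1 - u ^ 2) / u ^ 2) w :=
      ContDiffAt.div (by fun_prop) (by fun_prop) (by positivity)
    refine (ih _ hσ).comp (φ := fun u : ℝ => (1 - u ^ 2) / u ^ 2) hc ?_
    refine tendsto_nhdsWithin_iff.2 ⟨hc.continuousAt.tendsto.mono_left nhdsWithin_le_nhds, ?_⟩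
    filter_upwards [self_mem_nhdsWithin] with u hu
    have hu0 : 0 < u := hw.trans hu
    have hu' : w ^ 2 < u ^ 2 := pow_lt_pow_left₀ hu hw.le two_ne_zero
    rw [Set.mem_Iio, div_lt_div_iff₀ (by positivity) (by positivity)]
    linarith
  · refine HasSmoothGerm.congr (.of_contDiffAt (contDiffAt_const (c := 0))) (hev.trans ?_)
    filter_upwards [self_mem_nhdsWithin] with u hu
    have hu0 : 1 < u := h1.trans_lt hu
    rw [truncVol_of_neg _ (div_neg_of_neg_of_pos (by nlinarith) (by positivity)), mul_zero]

end TruncatedVolume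

section MainGerm

variable {E : Type*} [NormedAddCommGroup E] [InnerProductSpace ℝ E] [FiniteDimensional ℝ E]
  [MeasurableSpace E] [BorelSpace E]

theorem contDiffAt_sqrt_pow {N : ℕ} (m : ℕ) {σ : ℝ} (hσ : 0 < σ) :
    ContDiffAt ℝ N (fun x : ℝ => √x ^ m) σ :=
  (Real.contDiffAt_sqrt hσ.ne').pow m

theorem hasSmoothGerm_truncVol_cone (N : ℕ) {K : Set E} (hK : K ∈ conicSets E) {σ : ℝ}
    (hσ : 0 < σ) (l : Filter ℝ) (hl : l ≤ nhds σ) : HasSmoothGerm N (truncVol K) l σ := by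
  refine HasSmoothGerm.congr (.mul (.of_contDiffAt (contDiffAt_sqrt_pow (Module.finrank ℝ E) hσ))
    (.of_contDiffAt (contDiffAt_const (c := truncVol K 1)))) ?_
  filter_upwards [hl (eventually_gt_nhds hσ)] with τ hτ
  exact truncVol_eq_of_mem_conicSets hK hτ

/-- Scaling and slicing for a cone truncated by a half-space orthogonal to `e` and by a ball. -/
theorem truncVol_cone_inter_inner_mem {e : E} (he : ‖e‖ = 1) {K : Set E} (hK : K ∈ conicSets E)
    {H : Set E} {J : Set ℝ} (hJ : MeasurableSet J) {σ : ℝ} (hσ : 0 < σ)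
    (h : ∀ y, √σ • y ∈ H ↔ inner ℝ e y ∈ J) :
    truncVol (K ∩ H) σ = √σ ^ Module.finrank ℝ E * ∫ u in J,
      volume.real {z : (Submodule.span ℝ {e})ᗮ | u • e + z ∈ K ∩ {y | ‖y‖ ^ 2 ≤ 1}} := by
  have hKm := measurableSet_of_mem_polyhedralSets (conicSets_subset_polyhedralSets hK)
  rw [← measureReal_inter_inner_mem he (hKm.inter (measurableSet_norm_sq_le 1))
    ((measure_mono Set.inter_subset_right).trans_lt (volume_norm_sq_le_lt_top 1)) hJ]
  refine measureReal_eq_pow_mul_of_smul_mem_iff (Real.sqrt_pos.2 hσ) fun y => ?_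
  simp only [Set.mem_inter_iff, smul_mem_iff_of_mem_conicSets hK (Real.sqrt_pos.2 hσ),
    Set.mem_ofPred_eq, norm_smul, mul_pow, Real.norm_eq_abs, sq_abs, Real.sq_sqrt hσ.le, h,
    mul_le_iff_le_one_right hσ]
  tauto

theorem hasSmoothGerm_truncVol_truncatedCone (N : ℕ) {K : Set E} (hK : K ∈ conicSets E) {v : E}
    (hv : v ≠ 0)
    (ih : ∀ e : E, ‖e‖ = 1 → ∀ σ > 0,
      HasSmoothGerm N (truncVol {z : (Submodule.span ℝ {e})ᗮ | e + z ∈ K})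
        (nhdsWithin σ (Set.Iio σ)) σ) {H : Set E}
    (hH : H = {x | 1 ≤ inner ℝ v x} ∨ H = {x | 1 < inner ℝ v x}) {σ : ℝ} (hσ : 0 < σ) :
    HasSmoothGerm N (truncVol (K ∩ H)) (nhdsWithin σ (Set.Iio σ)) σ := by
  have hv' : 0 < ‖v‖ := norm_pos_iff.2 hv
  set e : E := ‖v‖⁻¹ • v with he_def
  have he : ‖e‖ = 1 := norm_smul_inv_norm hv
  have hve : ∀ (s : ℝ) (y : E), inner ℝ v (s • y) = s * ‖v‖ * inner ℝ e y := fun s y => by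
    rw [he_def, inner_smul_left, inner_smul_right, RCLike.conj_to_real]
    field_simp
  have hψ : ContDiffAt ℝ N (fun τ : ℝ => 1 / (√τ * ‖v‖)) σ :=
    contDiffAt_const.div ((Real.contDiffAt_sqrt hσ.ne').mul contDiffAt_const)
      (mul_pos (Real.sqrt_pos.2 hσ) hv').ne'
  have hψt : Tendsto (fun τ : ℝ => 1 / (√τ * ‖v‖)) (nhdsWithin σ (Set.Iio σ))
      (nhdsWithin (1 / (√σ * ‖v‖)) (Set.Ioi (1 / (√σ * ‖v‖)))) := by
    refine tendsto_nhdsWithin_iff.2 ⟨hψ.continuousAt.tendsto.mono_left nhdsWithin_le_nhds, ?_⟩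
    filter_upwards [Ioo_mem_nhdsLT hσ] with τ hτ
    exact one_div_lt_one_div_of_lt (mul_pos (Real.sqrt_pos.2 hτ.1) hv')
      (mul_lt_mul_of_pos_right (Real.sqrt_lt_sqrt hτ.1.le hτ.2) hv')
  have hw : 0 < 1 / (√σ * ‖v‖) := one_div_pos.2 (mul_pos (Real.sqrt_pos.2 hσ) hv')
  refine HasSmoothGerm.congr (.mul (.of_contDiffAt (contDiffAt_sqrt_pow (Module.finrank ℝ E) hσ))
    ((hasSmoothGerm_integral_Ioi_slice_cone N he hK (ih e he) hw).comp
      (φ := fun τ : ℝ => 1 / (√τ * ‖v‖)) hψ hψt)) ?_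
  filter_upwards [Ioo_mem_nhdsLT hσ] with τ hτ
  have hτ' := mul_pos (Real.sqrt_pos.2 hτ.1) hv'
  rcases hH with rfl | rfl
  · rw [← integral_Ici_eq_integral_Ioi]
    refine truncVol_cone_inter_inner_mem he hK measurableSet_Ici hτ.1 fun y => ?_
    rw [Set.mem_ofPred_eq, hve, Set.mem_Ici, div_le_iff₀' hτ']
  · refine truncVol_cone_inter_inner_mem he hK measurableSet_Ioi hτ.1 fun y => ?_
    rw [Set.mem_ofPred_eq, hve, Set.mem_Ioi, div_lt_iff₀' hτ']

theorem hasSmoothGerm_integral_of_mem_span (N : ℕ) {𝒢 : Set (E → ℝ)}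
    (h : ∀ f ∈ 𝒢, ∃ S : Set E, MeasurableSet S ∧ f = S.indicator 1 ∧
      ∀ σ > 0, HasSmoothGerm N (truncVol S) (nhdsWithin σ (Set.Iio σ)) σ)
    {f : E → ℝ} (hf : f ∈ Submodule.span ℝ 𝒢) :
    (∀ σ, IntegrableOn f {y | ‖y‖ ^ 2 ≤ σ}) ∧ ∀ σ > 0,
      HasSmoothGerm N (fun σ => ∫ y in {y | ‖y‖ ^ 2 ≤ σ}, f y) (nhdsWithin σ (Set.Iio σ)) σ := by
  induction hf using Submodule.span_induction with
  | mem f hf =>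
    obtain ⟨S, hS, rfl, hS'⟩ := h f hf
    refine ⟨fun σ => ?_, fun σ hσ => ?_⟩
    · exact (integrableOn_const (C := (1 : ℝ)) (volume_norm_sq_le_lt_top σ).ne).indicator hS
    · convert hS' σ hσ using 2 with τ
      rw [integral_indicator_one hS, measureReal_restrict_apply hS, truncVol]
  | zero => exact ⟨fun σ => integrableOn_zero, fun σ _ =>
      .of_contDiffAt (by simpa using contDiffAt_const)⟩
  | add f g _ _ hf hg =>
    refine ⟨fun σ => (hf.1 σ).add (hg.1 σ), fun σ hσ => ?_⟩
    convert (hf.2 σ hσ).add (hg.2 σ hσ) using 2 with τ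
    exact integral_add (hf.1 τ) (hg.1 τ)
  | smul r f _ hf =>
    refine ⟨fun σ => (hf.1 σ).smul r, fun σ hσ => ?_⟩
    convert (HasSmoothGerm.of_contDiffAt (contDiffAt_const (c := r))).mul (hf.2 σ hσ) using 2
      with τ
    exact integral_const_mul _ _

/-- The volume of the intersection of a polyhedral set with a centred ball depends smoothly on the
squared radius, on a left neighbourhood of each positive value. -/
theorem hasSmoothGerm_truncVol (N : ℕ) {S : Set E} (hS : S ∈ polyhedralSets E) {σ : ℝ}
    (hσ : 0 < σ) : HasSmoothGerm N (truncVol S) (nhdsWithin σ (Set.Iio σ)) σ := by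
  induction hm : Module.finrank ℝ E using Nat.strong_induction_on generalizing E σ with
  | _ m ih =>
  have h := (hasSmoothGerm_integral_of_mem_span N (𝒢 := truncatedConeIndicators E) ?_
    (indicator_mem_span_truncatedConeIndicators hS)).2 σ hσ
  · have hSm := measurableSet_of_mem_polyhedralSets hS
    convert h using 2 with τ
    rw [integral_indicator_one hSm, measureReal_restrict_apply hSm, truncVol]
  rintro f (⟨K, hK, a, ⟨v, rfl⟩, hf⟩ | ⟨K, hK, rfl⟩)
  · have hKm := measurableSet_of_mem_polyhedralSets (conicSets_subset_polyhedralSets hK)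
    obtain ⟨H, hH, hHm, rfl⟩ : ∃ H : Set E,
        (H = {x | 1 ≤ inner ℝ v x} ∨ H = {x | 1 < inner ℝ v x}) ∧ MeasurableSet H ∧
          f = (K ∩ H).indicator 1 := by
      rcases hf with rfl | rfl
      · exact ⟨_, Or.inl rfl, measurableSet_le (by fun_prop) (by fun_prop), rfl⟩
      · exact ⟨_, Or.inr rfl, measurableSet_lt (by fun_prop) (by fun_prop), rfl⟩
    refine ⟨_, hKm.inter hHm, rfl, fun σ hσ => ?_⟩
    rcases eq_or_ne v 0 with rfl | hv
    · have hH0 : H = ∅ := by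
        rcases hH with rfl | rfl <;> ext x <;> simp [zero_lt_one.not_ge, zero_le_one.not_gt]
      refine HasSmoothGerm.congr (.of_contDiffAt (contDiffAt_const (c := 0))) (.of_eq ?_)
      ext τ
      simp [truncVol, hH0]
    · refine hasSmoothGerm_truncVol_truncatedCone N hK hv (fun e he τ hτ => ?_) hH hσ
      have hrank := (Submodule.span ℝ {e}).finrank_add_finrank_orthogonal
      rw [finrank_span_singleton (norm_ne_zero_iff.1 (he ▸ one_ne_zero)), hm] at hrank
      exact ih _ (by omega)
        (preimage_add_coe_mem_polyhedralSets _ e (conicSets_subset_polyhedralSets hK)) hτ rfl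
  · exact ⟨K, measurableSet_of_mem_polyhedralSets (conicSets_subset_polyhedralSets hK), rfl,
      fun σ hσ => hasSmoothGerm_truncVol_cone N hK hσ _ nhdsWithin_le_nhds⟩

end MainGerm

section SingularKernel

open Complex Set Topology

theorem ofReal_sub_mul_I_mem_slitPlane (u : ℝ) {ε : ℝ} (hε : 0 < ε) :
    (u : ℂ) - ε * I ∈ slitPlane := by
  refine Or.inr ?_
  simp [hε.ne']

theorem ofReal_sub_mul_I_ne_zero (u : ℝ) {ε : ℝ} (hε : 0 < ε) : (u : ℂ) - ε * I ≠ 0 :=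
  slitPlane_ne_zero (ofReal_sub_mul_I_mem_slitPlane u hε)

theorem abs_le_norm_ofReal_sub_mul_I (u ε : ℝ) : |u| ≤ ‖(u : ℂ) - ε * I‖ := by
  simpa using abs_re_le_norm ((u : ℂ) - ε * I)

theorem le_norm_ofReal_sub_mul_I (u ε : ℝ) : ε ≤ ‖(u : ℂ) - ε * I‖ :=
  (le_abs_self ε).trans (by simpa using abs_im_le_norm ((u : ℂ) - ε * I))

theorem norm_zpow_neg_le {z : ℂ} {c : ℝ} (hc : 0 < c) (h : c ≤ ‖z‖) (n : ℕ) :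
    ‖z ^ (-(n : ℤ))‖ ≤ (c ^ n)⁻¹ := by
  rw [zpow_neg, zpow_natCast, norm_inv, norm_pow]
  gcongr

theorem continuous_ofReal_sub_mul_I_zpow {ε : ℝ} (hε : 0 < ε) (k : ℤ) :
    Continuous fun u : ℝ => ((u : ℂ) - ε * I) ^ k :=
  Continuous.zpow₀ (by fun_prop) k fun u => Or.inl (ofReal_sub_mul_I_ne_zero u hε)

theorem tendsto_ofReal_sub_mul_I (u : ℝ) :
    Tendsto (fun ε : ℝ => (u : ℂ) - ε * I) (𝓝[>] 0) (𝓝 u) := by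
  have h : Continuous fun ε : ℝ => (u : ℂ) - ε * I := by fun_prop
  simpa using (h.tendsto 0).mono_left nhdsWithin_le_nhds

theorem tendsto_ofReal_sub_mul_I_zpow {u : ℝ} (hu : u ≠ 0) (k : ℤ) :
    Tendsto (fun ε : ℝ => ((u : ℂ) - ε * I) ^ k) (𝓝[>] 0) (𝓝 ((u : ℂ) ^ k)) :=
  (tendsto_ofReal_sub_mul_I u).zpow₀ k (Or.inl (ofReal_ne_zero.2 hu))

theorem exists_tendsto_log_ofReal_sub_mul_I {u : ℝ} (hu : u ≠ 0) :
    ∃ L, Tendsto (fun ε : ℝ => Complex.log ((u : ℂ) - ε * I)) (𝓝[>] 0) (𝓝 L) := by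
  rcases hu.lt_or_gt with hu | hu
  · refine ⟨_, (tendsto_log_nhdsWithin_im_neg_of_re_neg_of_im_zero (z := u) (by simpa using hu)
      (by simp)).comp (tendsto_nhdsWithin_iff.2 ⟨tendsto_ofReal_sub_mul_I u, ?_⟩)⟩
    filter_upwards [self_mem_nhdsWithin] with ε hε
    simpa using hε
  · exact ⟨_, (tendsto_ofReal_sub_mul_I u).clog (Or.inl (by simpa using hu))⟩

theorem hasDerivAt_ofReal_sub_mul_I_zpow (u : ℝ) {ε : ℝ} (hε : 0 < ε) (k : ℤ) :
    HasDerivAt (fun u : ℝ => ((u : ℂ) - ε * I) ^ k) (k * ((u : ℂ) - ε * I) ^ (k - 1)) u := by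
  have h1 : HasDerivAt (fun z : ℂ => z - ε * I) 1 (u : ℂ) := (hasDerivAt_id _).sub_const _
  simpa using
    ((hasDerivAt_zpow k _ (Or.inl (ofReal_sub_mul_I_ne_zero u hε))).comp (u : ℂ) h1).comp_ofReal

theorem exists_tendsto_integral_inv_ofReal_sub_mul_I {δ : ℝ} (hδ : 0 < δ) :
    ∃ L, Tendsto (fun ε : ℝ => ∫ u in -δ..δ, ((u : ℂ) - ε * I)⁻¹) (𝓝[>] 0) (𝓝 L) := by
  obtain ⟨L₁, h₁⟩ := exists_tendsto_log_ofReal_sub_mul_I hδ.ne'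
  obtain ⟨L₂, h₂⟩ := exists_tendsto_log_ofReal_sub_mul_I (neg_ne_zero.2 hδ.ne')
  refine ⟨_, (h₁.sub h₂).congr' ?_⟩
  filter_upwards [self_mem_nhdsWithin] with ε hε
  refine (intervalIntegral.integral_eq_sub_of_hasDerivAt
    (f := fun u : ℝ => Complex.log ((u : ℂ) - ε * I)) (fun u _ => ?_) ?_).symm
  · have h1 : HasDerivAt (fun z : ℂ => z - ε * I) 1 (u : ℂ) := (hasDerivAt_id _).sub_const _
    simpa using (h1.clog (ofReal_sub_mul_I_mem_slitPlane u hε)).comp_ofReal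
  · have := continuous_ofReal_sub_mul_I_zpow hε (-1)
    simp only [zpow_neg_one] at this
    exact this.intervalIntegrable _ _

theorem eventually_exists_tendsto_integral_mul_zpow (n : ℕ) {g : ℝ → ℂ}
    (hg : ContDiffAt ℝ (n + 1 : ℕ) g 0) :
    ∀ᶠ δ in 𝓝[>] (0 : ℝ), ∃ L, Tendsto
      (fun ε : ℝ => ∫ u in -δ..δ, g u * ((u : ℂ) - ε * I) ^ (-((n + 1 : ℕ) : ℤ)))
      (𝓝[>] 0) (𝓝 L) := by
  have hball : ∀ {p : ℝ → Prop}, (∀ᶠ u in 𝓝 0, p u) →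
      ∀ᶠ δ in 𝓝[>] (0 : ℝ), ∀ u ∈ uIcc (-δ) δ, p u := fun {p} hp => by
    obtain ⟨r, hr, hp⟩ := Metric.eventually_nhds_iff_ball.1 hp
    filter_upwards [Ioo_mem_nhdsGT hr] with δ hδ u hu
    rw [uIcc_of_le (by linarith [hδ.1])] at hu
    exact hp u (by rw [mem_ball_zero_iff, Real.norm_eq_abs, abs_lt]; constructor <;>
      linarith [hδ.2, hu.1, hu.2])
  obtain ⟨g', ⟨s, hs, hgs⟩, hg'⟩ := contDiffAt_succ_iff_hasFDerivAt.1 hg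
  have hgd : ∀ᶠ u in 𝓝 (0 : ℝ), HasDerivAt g (g' u 1) u := by
    filter_upwards [hs] with u hu using (hgs u hu).hasDerivAt
  have hg'c : ContDiffAt ℝ n (fun u => g' u 1) 0 := hg'.clm_apply contDiffAt_const
  have hcont : ∀ᶠ u in 𝓝 (0 : ℝ), ContinuousAt (fun u => g' u 1) u :=
    (hg'c.eventually (by simp)).mono fun u hu => hu.continuousAt
  clear hs hgs
  induction n generalizing g g' with
  | zero =>
    obtain ⟨C, hC⟩ := hgd.self_of_nhds.isBigO_sub.bound
    filter_upwards [hball hC, hball hgd, self_mem_nhdsWithin] with δ hδC hδd hδ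
    have hgc : ContinuousOn g (uIcc (-δ) δ) := fun u hu =>
      (hδd u hu).continuousAt.continuousWithinAt
    obtain ⟨L, hL⟩ := exists_tendsto_integral_inv_ofReal_sub_mul_I hδ
    have hlim : Tendsto (fun ε : ℝ => ∫ u in -δ..δ, (g u - g 0) * ((u : ℂ) - ε * I)⁻¹) (𝓝[>] 0)
        (𝓝 (∫ u in -δ..δ, (g u - g 0) * (u : ℂ)⁻¹)) := by
      refine intervalIntegral.tendsto_integral_filter_of_dominated_convergence (fun _ => C)
        ?_ ?_ (by simp) ?_
      · filter_upwards [self_mem_nhdsWithin] with ε hε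
        have := continuous_ofReal_sub_mul_I_zpow hε (-1)
        simp only [zpow_neg_one] at this
        exact ((((hgc.sub continuousOn_const).mul this.continuousOn).mono
          uIoc_subset_uIcc).aestronglyMeasurable measurableSet_uIoc)
      · filter_upwards [self_mem_nhdsWithin] with ε hε
        refine ae_of_all _ fun u hu => ?_
        have hpos : 0 < ‖(u : ℂ) - ε * I‖ := norm_pos_iff.2 (ofReal_sub_mul_I_ne_zero u hε)
        have h1 := hδC u (uIoc_subset_uIcc hu)
        have h2 := hδC δ right_mem_uIcc
        have hC0 : 0 ≤ C := by
          have : 0 ≤ C * ‖δ - 0‖ := (norm_nonneg _).trans h2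
          rw [sub_zero, Real.norm_eq_abs, abs_of_pos hδ] at this
          exact nonneg_of_mul_nonneg_left this hδ
        rw [norm_mul, norm_inv, ← div_eq_mul_inv, div_le_iff₀ hpos]
        refine h1.trans ?_
        rw [sub_zero, Real.norm_eq_abs]
        exact mul_le_mul_of_nonneg_left (abs_le_norm_ofReal_sub_mul_I u ε) hC0
      · have h0 : ∀ᵐ u : ℝ, u ≠ 0 := by simp [ae_iff]
        filter_upwards [h0] with u hu _
        exact tendsto_const_nhds.mul ((tendsto_ofReal_sub_mul_I u).inv₀ (ofReal_ne_zero.2 hu))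
    refine ⟨_, (hlim.add (hL.const_mul (g 0))).congr' ?_⟩
    filter_upwards [self_mem_nhdsWithin] with ε hε
    have hk := continuous_ofReal_sub_mul_I_zpow hε (-1)
    simp only [zpow_neg_one] at hk
    rw [← intervalIntegral.integral_const_mul, ← intervalIntegral.integral_add]
    · refine intervalIntegral.integral_congr fun u _ => ?_
      simp only [zero_add, Nat.cast_one, zpow_neg_one]
      ring
    · exact ((hgc.sub continuousOn_const).mul hk.continuousOn).intervalIntegrable
    · exact (continuous_const.mul hk).intervalIntegrable _ _
  | succ n ih =>
    obtain ⟨g'', ⟨s', hs', hgs'⟩, hg''⟩ := contDiffAt_succ_iff_hasFDerivAt.1 hg'c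
    have hg''c : ContDiffAt ℝ n (fun u => g'' u 1) 0 := hg''.clm_apply contDiffAt_const
    have hind := ih hg'c g'' hg''
      (by filter_upwards [hs'] with u hu using (hgs' u hu).hasDerivAt) hg''c
      ((hg''c.eventually (by simp)).mono fun u hu => hu.continuousAt)
    filter_upwards [hind, hball hgd, hball hcont, self_mem_nhdsWithin] with δ ⟨L, hL⟩ hδd hδc hδ
    have hδ0 : δ ≠ 0 := ne_of_gt hδ
    set c : ℂ := -((n + 1 : ℕ) : ℂ) with hc
    have hc0 : c ≠ 0 := neg_ne_zero.2 (Nat.cast_ne_zero.2 n.succ_ne_zero)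
    have hb : ∀ {x : ℝ}, x ≠ 0 → Tendsto
        (fun ε : ℝ => g x * (((x : ℂ) - ε * I) ^ (-((n + 1 : ℕ) : ℤ)) / c)) (𝓝[>] 0)
        (𝓝 (g x * ((x : ℂ) ^ (-((n + 1 : ℕ) : ℤ)) / c))) := fun hx =>
      ((tendsto_ofReal_sub_mul_I_zpow hx _).div_const c).const_mul _
    refine ⟨_, (((hb hδ0).sub (hb (neg_ne_zero.2 hδ0))).sub (hL.div_const c)).congr' ?_⟩
    filter_upwards [self_mem_nhdsWithin] with ε hε
    rw [← intervalIntegral.integral_div]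
    have hv : ∀ u : ℝ, HasDerivAt
        (fun u : ℝ => ((u : ℂ) - ε * I) ^ (-((n + 1 : ℕ) : ℤ)) / c)
        (((u : ℂ) - ε * I) ^ (-((n + 1 + 1 : ℕ) : ℤ))) u := fun u => by
      convert! (hasDerivAt_ofReal_sub_mul_I_zpow u hε (-((n + 1 : ℕ) : ℤ))).div_const c using 1
      rw [eq_div_iff hc0, mul_comm, hc]
      push_cast
      ring_nf
    refine Eq.symm ((intervalIntegral.integral_mul_deriv_eq_deriv_mul hδd (fun u _ => hv u)
      (ContinuousOn.intervalIntegrable fun u hu => (hδc u hu).continuousWithinAt)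
      ((continuous_ofReal_sub_mul_I_zpow hε _).intervalIntegrable _ _)).trans ?_)
    simp only [mul_div_assoc]

theorem exists_tendsto_integral_mul_zpow {n : ℕ} (hn : n ≠ 0) {a : ℝ → ℝ} (ha : Integrable a)
    (h : HasSmoothGerm n a (𝓝[≠] 0) 0) :
    ∃ L, Tendsto (fun ε : ℝ => ∫ u : ℝ, (a u : ℂ) * ((u : ℂ) - ε * I) ^ (-(n : ℤ)))
      (𝓝[>] 0) (𝓝 L) := by
  obtain ⟨n, rfl⟩ := Nat.exists_eq_succ_of_ne_zero hn
  obtain ⟨g, hg, hag⟩ := h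
  obtain ⟨r, hr, hag⟩ := Metric.mem_nhdsWithin_iff.1 hag
  obtain ⟨δ, ⟨L, hL⟩, hδ⟩ := ((eventually_exists_tendsto_integral_mul_zpow n
    (ofRealCLM.contDiff.contDiffAt.comp (0 : ℝ) hg)).and (Ioo_mem_nhdsGT hr)).exists
  have hae : ∀ᵐ u : ℝ, u ≠ 0 := by simp [ae_iff]
  have hout : Tendsto (fun ε : ℝ => ∫ u in (Ioc (-δ) δ)ᶜ,
      (a u : ℂ) * ((u : ℂ) - ε * I) ^ (-((n + 1 : ℕ) : ℤ))) (𝓝[>] 0)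
      (𝓝 (∫ u in (Ioc (-δ) δ)ᶜ, (a u : ℂ) * (u : ℂ) ^ (-((n + 1 : ℕ) : ℤ)))) := by
    refine tendsto_integral_filter_of_dominated_convergence
      (fun u => ‖a u‖ * (δ ^ (n + 1))⁻¹) ?_ ?_ (ha.norm.mul_const _).integrableOn ?_
    · filter_upwards [self_mem_nhdsWithin] with ε hε
      exact (ha.ofReal.aestronglyMeasurable.mul
        (continuous_ofReal_sub_mul_I_zpow hε _).aestronglyMeasurable).restrict
    · filter_upwards with ε
      filter_upwards [ae_restrict_mem measurableSet_Ioc.compl] with u hu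
      rw [norm_mul, norm_real]
      have hu' : δ ≤ |u| := by
        rw [mem_compl_iff, mem_Ioc, not_and_or, not_lt, not_le] at hu
        rcases hu with hu | hu
        · exact le_abs.2 (Or.inr (by linarith))
        · exact le_abs.2 (Or.inl hu.le)
      exact mul_le_mul_of_nonneg_left (norm_zpow_neg_le hδ.1
        (hu'.trans (abs_le_norm_ofReal_sub_mul_I u ε)) _) (norm_nonneg _)
    · filter_upwards [ae_restrict_of_ae hae] with u hu
      exact (tendsto_ofReal_sub_mul_I_zpow hu _).const_mul _
  refine ⟨_, (hL.add hout).congr' ?_⟩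
  filter_upwards [self_mem_nhdsWithin] with ε hε
  have hint : Integrable fun u : ℝ =>
      (a u : ℂ) * ((u : ℂ) - ε * I) ^ (-((n + 1 : ℕ) : ℤ)) :=
    ha.ofReal.mul_bdd (continuous_ofReal_sub_mul_I_zpow hε _).aestronglyMeasurable
      (ae_of_all _ fun u => norm_zpow_neg_le hε (le_norm_ofReal_sub_mul_I u ε) _)
  rw [← integral_add_compl (measurableSet_Ioc (a := -δ) (b := δ)) hint,
    intervalIntegral.integral_of_le (by linarith [hδ.1])]
  congr 1
  refine setIntegral_congr_ae measurableSet_Ioc ?_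
  filter_upwards [hae] with u hu hu'
  have hau : a u = g u := hag ⟨by
    rw [mem_ball_zero_iff, Real.norm_eq_abs, abs_lt]
    constructor <;> linarith [hδ.2, hu'.1, hu'.2], hu⟩
  simp [hau]

end SingularKernel

section Vertical

variable {E : Type*} [NormedAddCommGroup E] [InnerProductSpace ℝ E]

/-- The algebra of sets generated by the affine half-spaces whose normal is orthogonal to `e`. -/
def verticalSets (e : E) : Set (Set E) :=
  generateSetAlgebra {H | ∃ (v : E) (t : ℝ), inner ℝ e v = 0 ∧ H = {x | t ≤ inner ℝ v x}}

/-- The span of the indicators of the intersections of a vertical set with a ball, open or closed,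
centred on the hyperplane orthogonal to `e`. -/
def verticalSpan (e : E) : Submodule ℝ (E → ℝ) :=
  Submodule.span ℝ (sublevelIndicators (verticalSets e)
    {a | ∃ (b : E) (k : ℝ), inner ℝ e b = 0 ∧ a = fun x => inner ℝ b x + k} fun x => ‖x‖ ^ 2)

theorem verticalSets_subset_polyhedralSets (e : E) : verticalSets e ⊆ polyhedralSets E :=
  generateSetAlgebra_mono fun _ ⟨v, t, _, h⟩ => ⟨v, t, h⟩

theorem smul_add_mem_iff_of_mem_verticalSets {e : E} {C : Set E} (hC : C ∈ verticalSets e) (u : ℝ)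
    (x : E) : u • e + x ∈ C ↔ x ∈ C := by
  induction hC with
  | base s hs =>
    obtain ⟨v, t, hv, rfl⟩ := hs
    simp [inner_add_right, inner_smul_right, real_inner_comm e v ▸ hv]
  | empty => rfl
  | compl s _ ih => exact not_congr ih
  | union s t _ _ ihs iht => exact or_congr ihs iht

theorem norm_sq_le_inner_add_iff (b x : E) (k : ℝ) :
    ‖x‖ ^ 2 ≤ inner ℝ b x + k ↔ ‖x - (2⁻¹ : ℝ) • b‖ ^ 2 ≤ k + ‖(2⁻¹ : ℝ) • b‖ ^ 2 := by
  rw [norm_sub_sq_real, inner_smul_right, real_inner_comm]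
  constructor <;> intro h <;> linarith

theorem norm_sq_lt_inner_add_iff (b x : E) (k : ℝ) :
    ‖x‖ ^ 2 < inner ℝ b x + k ↔ ‖x - (2⁻¹ : ℝ) • b‖ ^ 2 < k + ‖(2⁻¹ : ℝ) • b‖ ^ 2 := by
  rw [norm_sub_sq_real, inner_smul_right, real_inner_comm]
  constructor <;> intro h <;> linarith

theorem indicator_mul_mem_verticalSpan {e : E} {C : Set E} (hC : C ∈ verticalSets e) {f : E → ℝ}
    (hf : f ∈ verticalSpan e) : C.indicator 1 * f ∈ verticalSpan e := by
  induction hf using Submodule.span_induction with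
  | mem f hf =>
    exact Submodule.subset_span
      (indicator_mul_mem_sublevelIndicators isSetAlgebra_generateSetAlgebra hC hf)
  | zero => rw [mul_zero]; exact zero_mem _
  | add f g _ _ hf hg => rw [mul_add]; exact add_mem hf hg
  | smul r f _ hf => rw [mul_smul_comm]; exact Submodule.smul_mem _ _ hf

theorem mul_mem_verticalSpan {e : E} {f g : E → ℝ} (hf : f ∈ verticalSpan e)
    (hg : g ∈ verticalSpan e) : f * g ∈ verticalSpan e := by
  induction hf, hg using Submodule.span_induction₂ with
  | mem_mem f g hf hg =>
    refine mul_mem_span_sublevelIndicators isSetAlgebra_generateSetAlgebra ?_ hf hg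
    rintro _ ⟨b, k, hb, rfl⟩ _ ⟨b', k', hb', rfl⟩
    refine self_subset_generateSetAlgebra ⟨b' - b, k - k',
      by rw [inner_sub_right, hb, hb', sub_zero], ?_⟩
    ext x
    rw [Set.mem_ofPred_eq, Set.mem_ofPred_eq, inner_sub_left]
    constructor <;> intro h <;> linarith
  | zero_left g hg => rw [zero_mul]; exact zero_mem _
  | zero_right f hf => rw [mul_zero]; exact zero_mem _
  | add_left f g h _ _ _ h1 h2 => rw [add_mul]; exact add_mem h1 h2
  | add_right f g h _ _ _ h1 h2 => rw [mul_add]; exact add_mem h1 h2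
  | smul_left r f g _ _ h => rw [smul_mul_assoc]; exact Submodule.smul_mem _ _ h
  | smul_right r f g _ _ h => rw [mul_smul_comm]; exact Submodule.smul_mem _ _ h

theorem indicator_closedBall_mem_verticalSpan {e c : E} (hc : inner ℝ e c = 0) {r : ℝ}
    (hr : 0 ≤ r) : (closedBall c r).indicator 1 ∈ verticalSpan e := by
  refine Submodule.subset_span ⟨Set.univ, isSetAlgebra_generateSetAlgebra.univ_mem, _,
    ⟨(2 : ℝ) • c, r ^ 2 - ‖c‖ ^ 2, by rw [inner_smul_right, hc, mul_zero], rfl⟩, Or.inl ?_⟩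
  congr 1
  ext x
  simp only [Set.univ_inter, Set.mem_ofPred_eq]
  rw [norm_sq_le_inner_add_iff, inv_smul_smul₀ two_ne_zero, sub_add_cancel,
    mem_closedBall_iff_norm, sq_le_sq₀ (norm_nonneg _) hr]

theorem indicator_ball_mem_verticalSpan {e c : E} (hc : inner ℝ e c = 0) {r : ℝ} (hr : 0 ≤ r) :
    (ball c r).indicator 1 ∈ verticalSpan e := by
  refine Submodule.subset_span ⟨Set.univ, isSetAlgebra_generateSetAlgebra.univ_mem, _,
    ⟨(2 : ℝ) • c, r ^ 2 - ‖c‖ ^ 2, by rw [inner_smul_right, hc, mul_zero], rfl⟩, Or.inr ?_⟩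
  congr 1
  ext x
  simp only [Set.univ_inter, Set.mem_ofPred_eq]
  rw [norm_sq_lt_inner_add_iff, inv_smul_smul₀ two_ne_zero, sub_add_cancel,
    mem_ball_iff_norm, sq_lt_sq₀ (norm_nonneg _) hr]

variable [FiniteDimensional ℝ E] [MeasurableSpace E] [BorelSpace E]

theorem volume_norm_sq_le_inner_add_lt_top (b : E) (k : ℝ) :
    volume {x : E | ‖x‖ ^ 2 ≤ inner ℝ b x + k} < ⊤ := by
  refine lt_of_le_of_lt (measure_mono fun x hx => ?_) (measure_closedBall_lt_top
    (x := (2⁻¹ : ℝ) • b) (r := √(k + ‖(2⁻¹ : ℝ) • b‖ ^ 2)))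
  rw [mem_closedBall_iff_norm]
  exact Real.le_sqrt_of_sq_le ((norm_sq_le_inner_add_iff b x k).1 hx)

theorem indicator_norm_sq_lt_ae_eq [Nontrivial E] (C : Set E) (b : E) (k : ℝ) :
    (C ∩ {x | ‖x‖ ^ 2 < inner ℝ b x + k}).indicator (1 : E → ℝ) =ᵐ[volume]
      (C ∩ {x | ‖x‖ ^ 2 ≤ inner ℝ b x + k}).indicator 1 := by
  have hnull := Measure.addHaar_sphere (volume : Measure E) ((2⁻¹ : ℝ) • b)
    √(k + ‖(2⁻¹ : ℝ) • b‖ ^ 2)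
  filter_upwards [measure_eq_zero_iff_ae_notMem.1 hnull] with x hx
  have hne : ‖x‖ ^ 2 ≠ inner ℝ b x + k := fun h => by
    refine hx (mem_sphere_iff_norm.2 ?_)
    rw [← le_antisymm ((norm_sq_le_inner_add_iff b x k).1 h.le)
      (not_lt.1 fun h' => ((norm_sq_lt_inner_add_iff b x k).2 h').ne h),
      Real.sqrt_sq (norm_nonneg _)]
  have hlt : ‖x‖ ^ 2 < inner ℝ b x + k ↔ ‖x‖ ^ 2 ≤ inner ℝ b x + k :=
    ⟨le_of_lt, fun h => lt_of_le_of_ne h hne⟩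
  have hiff : x ∈ C ∩ {x | ‖x‖ ^ 2 < inner ℝ b x + k} ↔ x ∈ C ∩ {x | ‖x‖ ^ 2 ≤ inner ℝ b x + k} :=
    and_congr_right fun _ => hlt
  by_cases h : x ∈ C ∩ {x | ‖x‖ ^ 2 ≤ inner ℝ b x + k}
  · rw [Set.indicator_of_mem h, Set.indicator_of_mem (hiff.2 h)]
  · rw [Set.indicator_of_notMem h, Set.indicator_of_notMem (mt hiff.1 h)]

theorem measureReal_slice_vertical {e : E} (he : ‖e‖ = 1) {C : Set E} (hC : C ∈ verticalSets e)
    (p : (Submodule.span ℝ {e})ᗮ) (k u : ℝ) :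
    volume.real {z : (Submodule.span ℝ {e})ᗮ | u • e + (z : E) ∈
      C ∩ {x | ‖x‖ ^ 2 ≤ inner ℝ ((2 : ℝ) • (p : E)) x + k}} =
      truncVol {z : (Submodule.span ℝ {e})ᗮ | (p : E) + z ∈ C} (k + ‖p‖ ^ 2 - u ^ 2) := by
  rw [truncVol, measureReal_def, measureReal_def, ← measure_preimage_add volume p]
  congr 2
  ext z
  have hpe : inner ℝ (p : E) e = 0 := Submodule.mem_orthogonal_singleton_iff_inner_left.1 p.2
  have h1 : u • e + ((p : E) + z) ∈ C ↔ (p : E) + z ∈ C :=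
    smul_add_mem_iff_of_mem_verticalSets hC u _
  have h2 := norm_smul_add_orthogonal_sq he u (p + z)
  have h3 : ‖p + z‖ ^ 2 = _ := norm_add_sq_real p z
  have h4 : inner ℝ ((2 : ℝ) • (p : E)) (u • e + ((p + z : (Submodule.span ℝ {e})ᗮ) : E)) =
      2 * (‖p‖ ^ 2 + inner ℝ p z) := by
    rw [inner_smul_left, inner_add_right, inner_smul_right, hpe, Submodule.coe_add,
      inner_add_right, real_inner_self_eq_norm_sq]
    simp
  simp only [Set.mem_preimage, Set.mem_inter_iff, Set.mem_ofPred_eq, h2, h4]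
  rw [Submodule.coe_add, h1, h3]
  refine and_congr_right fun _ => ?_
  constructor <;> intro h <;> linarith

theorem hasSmoothGerm_measureReal_slice_vertical (N : ℕ) {e : E} (he : ‖e‖ = 1) {C : Set E}
    (hC : C ∈ verticalSets e) {b : E} (hb : inner ℝ e b = 0) (k : ℝ) :
    HasSmoothGerm N (fun u : ℝ => volume.real {z : (Submodule.span ℝ {e})ᗮ |
      u • e + (z : E) ∈ C ∩ {x | ‖x‖ ^ 2 ≤ inner ℝ b x + k}}) (nhdsWithin 0 {0}ᶜ) 0 := by
  obtain ⟨p, rfl⟩ : ∃ p : (Submodule.span ℝ {e})ᗮ, b = (2 : ℝ) • (p : E) :=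
    ⟨⟨(2⁻¹ : ℝ) • b, Submodule.smul_mem _ _
      (Submodule.mem_orthogonal_singleton_iff_inner_right.2 hb)⟩,
      (smul_inv_smul₀ two_ne_zero b).symm⟩
  simp only [measureReal_slice_vertical he hC]
  rcases lt_or_ge 0 (k + ‖p‖ ^ 2) with hR | hR
  · refine HasSmoothGerm.comp (φ := fun u : ℝ => k + ‖p‖ ^ 2 - u ^ 2)
      (l := nhdsWithin (k + ‖p‖ ^ 2) (Set.Iio (k + ‖p‖ ^ 2))) ?_ (by fun_prop) ?_
    · rw [zero_pow two_ne_zero, sub_zero]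
      exact hasSmoothGerm_truncVol N (preimage_add_coe_mem_polyhedralSets _ _
        (verticalSets_subset_polyhedralSets e hC)) hR
    · refine tendsto_nhdsWithin_iff.2 ⟨?_, ?_⟩
      · have : Continuous fun u : ℝ => k + ‖p‖ ^ 2 - u ^ 2 := by fun_prop
        simpa using (this.tendsto 0).mono_left nhdsWithin_le_nhds
      · filter_upwards [self_mem_nhdsWithin] with u hu
        exact sub_lt_self _ (sq_pos_of_ne_zero hu)
  · refine HasSmoothGerm.congr (.of_contDiffAt (contDiffAt_const (c := 0))) ?_
    filter_upwards [self_mem_nhdsWithin] with u hu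
    refine truncVol_of_neg _ ?_
    have : 0 < u ^ 2 := sq_pos_of_ne_zero hu
    linarith

end Vertical

section Limit

open Complex

variable {E : Type*} [NormedAddCommGroup E] [InnerProductSpace ℝ E] [FiniteDimensional ℝ E]
  [MeasurableSpace E] [BorelSpace E]

theorem integrable_mul_inner_sub_mul_I_zpow (n : ℕ) (e : E) {f : E → ℝ} (hf : Integrable f) {ε : ℝ}
    (hε : 0 < ε) :
    Integrable fun x => (f x : ℂ) * ((inner ℝ e x : ℝ) - ε * I : ℂ) ^ (-(n : ℤ)) :=
  hf.ofReal.mul_bdd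
    ((continuous_ofReal_sub_mul_I_zpow hε _).comp
      (g := fun u : ℝ => ((u : ℂ) - ε * I) ^ (-(n : ℤ))) (by fun_prop)).aestronglyMeasurable
    (ae_of_all _ fun _ => norm_zpow_neg_le hε (le_norm_ofReal_sub_mul_I _ ε) _)

theorem exists_tendsto_integral_indicator_mul_zpow {n : ℕ} (hn : n ≠ 0) {e : E} (he : ‖e‖ = 1)
    {C : Set E} (hC : C ∈ verticalSets e) {b : E} (hb : inner ℝ e b = 0) (k : ℝ) :
    Integrable ((C ∩ {x | ‖x‖ ^ 2 ≤ inner ℝ b x + k}).indicator (1 : E → ℝ)) ∧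
      ∃ L, Tendsto (fun ε : ℝ => ∫ x, (((C ∩ {x | ‖x‖ ^ 2 ≤ inner ℝ b x + k}).indicator
        (1 : E → ℝ) x : ℝ) : ℂ) * ((inner ℝ e x : ℝ) - ε * I : ℂ) ^ (-(n : ℤ)))
        (nhdsWithin 0 (Set.Ioi 0)) (nhds L) := by
  set A := C ∩ {x | ‖x‖ ^ 2 ≤ inner ℝ b x + k}
  have hAm : MeasurableSet A :=
    (measurableSet_of_mem_polyhedralSets (verticalSets_subset_polyhedralSets e hC)).inter
      (measurableSet_le (by fun_prop) (by fun_prop))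
  have hAv : volume A < ⊤ :=
    (measure_mono Set.inter_subset_right).trans_lt (volume_norm_sq_le_inner_add_lt_top b k)
  have hint : Integrable (A.indicator (1 : E → ℝ)) :=
    (integrable_indicator_iff hAm).2 (integrableOn_const (C := (1 : ℝ)) hAv.ne)
  obtain ⟨L, hL⟩ := exists_tendsto_integral_mul_zpow hn (integrable_measureReal_slice he hAm hAv)
    (hasSmoothGerm_measureReal_slice_vertical n he hC hb k)
  refine ⟨hint, L, hL.congr' ?_⟩
  filter_upwards [self_mem_nhdsWithin] with ε hε
  rw [integral_eq_integral_slice he (integrable_mul_inner_sub_mul_I_zpow n e hint hε)]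
  congr 1
  ext u
  simp only [inner_smul_add_orthogonal he]
  rw [integral_mul_const, integral_complex_ofReal]
  have hm : MeasurableSet {z : (Submodule.span ℝ {e})ᗮ | u • e + z ∈ A} :=
    hAm.preimage (by fun_prop)
  congr 2
  exact (integral_indicator_one hm).symm

theorem exists_tendsto_integral_mul_zpow_of_mem_verticalSpan {n : ℕ} (hn : n ≠ 0) {e : E}
    (he : ‖e‖ = 1) {f : E → ℝ} (hf : f ∈ verticalSpan e) :
    Integrable f ∧ ∃ L, Tendsto
      (fun ε : ℝ => ∫ x, (f x : ℂ) * ((inner ℝ e x : ℝ) - ε * I : ℂ) ^ (-(n : ℤ)))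
      (nhdsWithin 0 (Set.Ioi 0)) (nhds L) := by
  induction hf using Submodule.span_induction with
  | mem f hf =>
    obtain ⟨C, hC, _, ⟨b, k, hb, rfl⟩, hf⟩ := hf
    obtain ⟨hint, L, hL⟩ := exists_tendsto_integral_indicator_mul_zpow hn he hC hb k
    rcases hf with rfl | rfl
    · exact ⟨hint, L, hL⟩
    · have : Nontrivial E := ⟨e, 0, norm_ne_zero_iff.1 (he ▸ one_ne_zero)⟩
      have hae := indicator_norm_sq_lt_ae_eq C b k
      refine ⟨hint.congr hae.symm, L, hL.congr fun ε => integral_congr_ae ?_⟩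
      filter_upwards [hae] with x hx
      rw [hx]
  | zero => exact ⟨integrable_zero _ _ _, 0, by simp⟩
  | add f g _ _ hf hg =>
    obtain ⟨hf, L, hL⟩ := hf
    obtain ⟨hg, L', hL'⟩ := hg
    refine ⟨hf.add hg, L + L', (hL.add hL').congr' ?_⟩
    filter_upwards [self_mem_nhdsWithin] with ε hε
    rw [← integral_add (integrable_mul_inner_sub_mul_I_zpow n e hf hε)
      (integrable_mul_inner_sub_mul_I_zpow n e hg hε)]
    simp [add_mul]
  | smul r f _ hf =>
    obtain ⟨hf, L, hL⟩ := hf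
    refine ⟨hf.smul r, r * L, (hL.const_mul (r : ℂ)).congr fun ε => ?_⟩
    rw [← integral_const_mul]
    simp [mul_assoc]

end Limit

theorem IsDHHalfSpace.isClosed {H : Set (EuclideanSpace ℝ (Fin n))} (hH : IsDHHalfSpace H) :
    IsClosed H := by
  rcases hH with ⟨c, r, -, -, rfl⟩ | ⟨c, r, -, -, rfl⟩ | ⟨v, t, -, -, rfl⟩
  · exact isClosed_closedBall
  · exact isOpen_ball.isClosed_compl
  · exact isClosed_le (by fun_prop) (by fun_prop)

theorem IsDHHalfSpace.indicator_mul_mem_verticalSpan {H : Set (EuclideanSpace ℝ (Fin n))}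
    (hH : IsDHHalfSpace H) {f : EuclideanSpace ℝ (Fin n) → ℝ}
    (hf : f ∈ verticalSpan (EuclideanSpace.single (0 : Fin n) (1 : ℝ))) :
    H.indicator 1 * f ∈ verticalSpan (EuclideanSpace.single (0 : Fin n) (1 : ℝ)) := by
  have h0 : ∀ {c : EuclideanSpace ℝ (Fin n)}, c 0 = 0 →
      inner ℝ (EuclideanSpace.single (0 : Fin n) (1 : ℝ)) c = 0 := fun hc => by
    simp [EuclideanSpace.inner_single_left, hc]
  rcases hH with ⟨c, r, hr, hc, rfl⟩ | ⟨c, r, hr, hc, rfl⟩ | ⟨v, t, -, hv, rfl⟩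
  · exact mul_mem_verticalSpan (indicator_closedBall_mem_verticalSpan (h0 hc) hr.le) hf
  · rw [Set.indicator_compl, sub_mul, one_mul]
    exact sub_mem hf (mul_mem_verticalSpan (indicator_ball_mem_verticalSpan (h0 hc) hr.le) hf)
  · exact _root_.indicator_mul_mem_verticalSpan
      (self_subset_generateSetAlgebra ⟨v, t, h0 hv, rfl⟩) hf

theorem IsDHPolytope.indicator_mem_verticalSpan {P : Set (EuclideanSpace ℝ (Fin n))}
    (hP : IsDHPolytope P) (hPb : Bornology.IsBounded P) :
    P.indicator 1 ∈ verticalSpan (EuclideanSpace.single (0 : Fin n) (1 : ℝ)) := by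
  classical
  obtain ⟨R, hR, hPR⟩ := hPb.subset_closedBall_lt 0 0
  obtain ⟨S, hS, rfl⟩ := hP
  rw [← Set.inter_eq_left.2 hPR]
  clear hPR hPb
  rw [Set.inter_indicator_one]
  have hball : (closedBall (0 : EuclideanSpace ℝ (Fin n)) R).indicator 1 ∈
      verticalSpan (EuclideanSpace.single (0 : Fin n) (1 : ℝ)) :=
    indicator_closedBall_mem_verticalSpan (inner_zero_right _) hR.le
  induction S using Finset.induction_on with
  | empty => simpa using hball
  | insert H S _ ih =>
    rw [Finset.coe_insert, Set.sInter_insert, Set.inter_indicator_one, mul_assoc]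
    exact (hS H (Finset.mem_insert_self H S)).indicator_mul_mem_verticalSpan
      (ih fun H' hH' => hS H' (Finset.mem_insert_of_mem hH'))

/-- **Existence of the volume of a DH-polytope** (part of Theorem 3.2 / Lemma 6.1(1)):
for every bounded DH-polytope `P ⊆ ℝⁿ` the limit `V_n(P) = lim_{ε→0⁺} μ_ε(P)` exists. -/
theorem dh_volume_exists (n : ℕ) [NeZero n] (P : Set (EuclideanSpace ℝ (Fin n)))
    (hP : IsDHPolytope P) (hPb : Bornology.IsBounded P) :
    ∃ L : ℂ, Tendsto (fun ε : ℝ => dhInt n P ε) (nhdsWithin 0 (Set.Ioi 0)) (nhds L) := by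
  have hPm : MeasurableSet P := by
    obtain ⟨S, hS, rfl⟩ := hP
    exact (isClosed_sInter fun H hH => (hS H hH).isClosed).measurableSet
  obtain ⟨-, L, hL⟩ := exists_tendsto_integral_mul_zpow_of_mem_verticalSpan (NeZero.ne n)
    (by simp) (hP.indicator_mem_verticalSpan hPb)
  refine ⟨L, hL.congr fun ε => ?_⟩
  rw [dhInt, ← integral_indicator hPm]
  congr 1
  ext x
  by_cases hx : x ∈ P <;> simp [hx, EuclideanSpace.inner_single_left]
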